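/- For each fixed integer k ≥ 2, the generating function of the numbers p_{nk} satisfies the formal power series identity (1 - z^{k-1})·(1 - z)² · ∑_{n≥0} p_{nk} z^n = z^k in ℤ[[z]]. -/

import Mathlib

open scoped Classical

/-- An arithmetic progression of integers: a finite set of the form
`{a, a+r, ..., a+(k-1)r}` with `a : ℤ`, `r ≥ 1` and `k ≥ 0` (so the empty set and all
singletons are arithmetic progressions). -/
def IsAP (s : Finset ℤ) : Prop :=
  ∃ (a r : ℤ) (k : ℕ), 1 ≤ r ∧ s = (Finset.range k).image (fun i => a + (i : ℤ) * r)

/-- The number `p_{nk}` of arithmetic progressions of cardinality `k` contained in `{1,…,n}`. -/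
noncomputable def numAP (n k : ℕ) : ℕ :=
  ((Finset.Icc (1:ℤ) (n:ℤ)).powerset.filter (fun s => IsAP s ∧ s.card = k)).card

/-- The Möbius function of the poset of arithmetic progressions ordered by inclusion,
defined by `μ(x,x) = 1` and `μ(x,y) = -∑_{x ≤ z < y} μ(x,z)`, where `z` ranges over
arithmetic progressions with `x ⊆ z ⊂ y`.  (For `x ⊆ y ⊆ {1,…,n}`, all arithmetic
progressions `z` with `x ⊆ z ⊂ y` automatically lie in `L_n`, so this is the Möbius
function of any interval `[x, y]` of the lattice `L_n`.) -/
noncomputable def apMu (x y : Finset ℤ) : ℤ :=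
  if x = y then 1
  else - ∑ z ∈ (y.powerset.filter (fun z => IsAP z ∧ x ⊆ z ∧ z ≠ y)).attach, apMu x z.1
termination_by y.card
decreasing_by
  rename_i z
  have hz := z.2
  rw [Finset.mem_filter, Finset.mem_powerset] at hz
  exact Finset.card_lt_card (lt_of_le_of_ne hz.1 hz.2.2.2)

/-- The join of `a` and `b` in the lattice of arithmetic progressions contained in `t`:
the intersection of all arithmetic progressions contained in `t` that contain `a ∪ b`,
i.e. the smallest such progression. -/
noncomputable def apJoin (t a b : Finset ℤ) : Finset ℤ :=
  t.filter (fun v => ∀ z : Finset ℤ, IsAP z → z ⊆ t → a ∪ b ⊆ z → v ∈ z)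

/-- The meet (intersection) of a finite family `S` of subsets of the top element `t`;
the meet of the empty family is `t` itself. -/
def apMeet (t : Finset ℤ) (S : Finset (Finset ℤ)) : Finset ℤ :=
  S.fold (· ⊓ ·) t id

/-- `x` is a coatom of the lattice `L_n` of arithmetic progressions contained in
`{1,…,n}`: an element distinct from the maximum `{1,…,n}` with no element strictly
between it and the maximum. -/
def IsCoatomIn (n : ℕ) (x : Finset ℤ) : Prop :=
  IsAP x ∧ x ⊆ Finset.Icc (1:ℤ) (n:ℤ) ∧ x ≠ Finset.Icc (1:ℤ) (n:ℤ) ∧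
    ∀ y : Finset ℤ, IsAP y → y ⊆ Finset.Icc (1:ℤ) (n:ℤ) → x ⊂ y → y = Finset.Icc (1:ℤ) (n:ℤ)

/-- `y` is covered by `top` in the poset of arithmetic progressions: `y < top` and there
is no arithmetic progression strictly between them. -/
def CoveredIn (top y : Finset ℤ) : Prop :=
  IsAP y ∧ y ⊂ top ∧ ¬ ∃ z : Finset ℤ, IsAP z ∧ y ⊂ z ∧ z ⊂ top

/-- `c` is a maximal chain in the lattice `L_n` of arithmetic progressions contained
in `{1,…,n}`: a chain (under inclusion) of elements of `L_n` to which no further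
element of `L_n` can be added. -/
def IsMaxChainIn (n : ℕ) (c : Finset (Finset ℤ)) : Prop :=
  (∀ s ∈ c, IsAP s ∧ s ⊆ Finset.Icc (1:ℤ) (n:ℤ)) ∧
  IsChain (· ⊆ ·) (↑c : Set (Finset ℤ)) ∧
  ∀ z : Finset ℤ, IsAP z → z ⊆ Finset.Icc (1:ℤ) (n:ℤ) →
    IsChain (· ⊆ ·) (insert z (↑c : Set (Finset ℤ))) → z ∈ c

/-- The number `b_{nk}` of chains of length `k` (i.e. totally ordered subsets with `k+1`
elements) in `L_n` that contain both `∅` and `{1,…,n}`. -/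
noncomputable def numChains (n k : ℕ) : ℕ :=
  (((Finset.Icc (1:ℤ) (n:ℤ)).powerset.filter IsAP).powerset.filter
    (fun c : Finset (Finset ℤ) => c.card = k + 1 ∧ ∅ ∈ c ∧ Finset.Icc (1:ℤ) (n:ℤ) ∈ c ∧
      IsChain (· ⊆ ·) (↑c : Set (Finset ℤ)))).card

theorem injective_add_mul {a r : ℤ} (hr : 1 ≤ r) :
    Function.Injective (fun i : ℕ => a + (i : ℤ) * r) := by
  intro i j h
  have h' : (i : ℤ) * r = j * r := by simpa using h
  exact_mod_cast mul_right_cancel₀ (by omega : r ≠ 0) h'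

theorem isAP_iff {s : Finset ℤ} :
    IsAP s ↔ ∃ (a r : ℤ) (k : ℕ),
      1 ≤ r ∧ s = (Finset.range k).image (fun i : ℕ => a + (i : ℤ) * r) := by
  have h (a r : ℤ) (k : ℕ) : (Finset.range k).image (fun i => a + (i : ℤ) * r) =
      (Finset.range k).image (fun i : ℕ => a + (i : ℤ) * r) := by
    ext x
    simp
  simp only [IsAP, h]

theorem isAP_and_card_eq_iff {s : Finset ℤ} {k : ℕ} :
    IsAP s ∧ s.card = k ↔
      ∃ a r : ℤ, 1 ≤ r ∧ s = (Finset.range k).image (fun i : ℕ => a + (i : ℤ) * r) := by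
  rw [isAP_iff]
  constructor
  · rintro ⟨⟨a, r, l, hr, rfl⟩, hc⟩
    rw [Finset.card_image_of_injective _ (injective_add_mul hr), Finset.card_range] at hc
    exact ⟨a, r, hr, by rw [hc]⟩
  · rintro ⟨a, r, hr, rfl⟩
    exact ⟨⟨a, r, k, hr, rfl⟩, by
      rw [Finset.card_image_of_injective _ (injective_add_mul hr), Finset.card_range]⟩

/-- The progressions with `d + 1` elements and a given largest element are determined by
their common difference. -/
theorem injective_image_sub_mul (m : ℤ) {d : ℕ} (hd : 1 ≤ d) :
    Function.Injective (fun r : ℕ =>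
      (Finset.range (d + 1)).image (fun i : ℕ => m - d * r + (i : ℤ) * r)) := by
  have key : ∀ r t : ℕ, (Finset.range (d + 1)).image (fun i : ℕ => m - d * r + (i : ℤ) * r) =
      (Finset.range (d + 1)).image (fun i : ℕ => m - d * t + (i : ℤ) * t) → r ≤ t := by
    intro r t h
    have hmem : m - d * r ∈
        (Finset.range (d + 1)).image (fun i : ℕ => m - d * t + (i : ℤ) * t) := by
      rw [← h, Finset.mem_image]
      exact ⟨0, by simp, by simp⟩
    obtain ⟨i, -, hi⟩ := Finset.mem_image.1 hmem
    have hit : (0 : ℤ) ≤ (i : ℤ) * t := by positivity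
    have hle : (d : ℤ) * r ≤ d * t := by linarith
    exact Nat.le_of_mul_le_mul_left (by exact_mod_cast hle) hd
  exact fun r t h => le_antisymm (key r t h) (key t r h.symm)

theorem numAP_zero {d : ℕ} : numAP 0 (d + 1) = 0 := by
  rw [numAP, Finset.card_eq_zero, Finset.filter_eq_empty_iff]
  rintro s hs ⟨-, hc⟩
  have : s = ∅ := by simpa using hs
  simp [this] at hc

theorem numAP_succ (n : ℕ) {d : ℕ} (hd : 1 ≤ d) :
    numAP (n + 1) (d + 1) = numAP n (d + 1) + n / d := by
  have hcard : ((Finset.Icc 1 (n / d)).image (fun r : ℕ => (Finset.range (d + 1)).image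
      (fun i : ℕ => ((n : ℤ) + 1) - d * r + (i : ℤ) * r))).card = n / d := by
    rw [Finset.card_image_of_injective _ (injective_image_sub_mul _ hd), Nat.card_Icc,
      Nat.add_sub_cancel]
  rw [numAP, numAP]
  conv_rhs => rw [← hcard]
  rw [← Finset.card_union_of_disjoint]
  · congr 1
    ext s
    rw [Finset.mem_union, Finset.mem_filter, Finset.mem_filter, Finset.mem_image]
    constructor
    · rintro ⟨hs, hAP⟩
      rw [Finset.mem_powerset] at hs
      by_cases hn : (n : ℤ) + 1 ∈ s
      · right
        obtain ⟨a, r, hr, rfl⟩ := isAP_and_card_eq_iff.1 hAP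
        have hfirst : a ∈ Finset.Icc (1 : ℤ) ((n + 1 : ℕ) : ℤ) :=
          hs (Finset.mem_image.2 ⟨0, by simp, by simp⟩)
        have hlast : a + (d : ℤ) * r ∈ Finset.Icc (1 : ℤ) ((n + 1 : ℕ) : ℤ) :=
          hs (Finset.mem_image.2 ⟨d, by simp, rfl⟩)
        obtain ⟨i, hi, hin⟩ := Finset.mem_image.1 hn
        rw [Finset.mem_Icc] at hfirst hlast
        rw [Finset.mem_range] at hi
        have hid : (i : ℤ) * r ≤ d * r :=
          mul_le_mul_of_nonneg_right (by exact_mod_cast Nat.lt_succ_iff.1 hi) (by omega)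
        push_cast at hlast
        have ha : (n : ℤ) + 1 - d * r = a := by linarith
        lift r to ℕ using by omega
        refine ⟨r, Finset.mem_Icc.2 ⟨by exact_mod_cast hr, ?_⟩, by rw [ha]⟩
        rw [Nat.le_div_iff_mul_le hd, mul_comm]
        have : (d : ℤ) * r ≤ n := by linarith
        exact_mod_cast this
      · left
        refine ⟨Finset.mem_powerset.2 fun x hx => ?_, hAP⟩
        have h := Finset.mem_Icc.1 (hs hx)
        have hne : x ≠ n + 1 := fun h => hn (h ▸ hx)
        push_cast at h
        exact Finset.mem_Icc.2 (by omega)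
    · rintro (⟨hs, hAP⟩ | ⟨r, hr, rfl⟩)
      · exact ⟨Finset.mem_powerset.2 ((Finset.mem_powerset.1 hs).trans
          (Finset.Icc_subset_Icc_right (by push_cast; omega))), hAP⟩
      · rw [Finset.mem_Icc, Nat.le_div_iff_mul_le hd] at hr
        refine ⟨Finset.mem_powerset.2 fun x hx => ?_,
          isAP_and_card_eq_iff.2 ⟨_, r, by exact_mod_cast hr.1, rfl⟩⟩
        obtain ⟨i, hi, rfl⟩ := Finset.mem_image.1 hx
        rw [Finset.mem_range] at hi
        have hid : (i : ℤ) * r ≤ d * r :=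
          mul_le_mul_of_nonneg_right (by exact_mod_cast Nat.lt_succ_iff.1 hi) (by omega)
        have hi0 : (0 : ℤ) ≤ (i : ℤ) * r := by positivity
        have hrn : (r : ℤ) * d ≤ n := by exact_mod_cast hr.2
        rw [Finset.mem_Icc]
        push_cast
        constructor <;> linarith
  · rw [Finset.disjoint_left]
    intro s hs hs'
    obtain ⟨r, -, rfl⟩ := Finset.mem_image.1 hs'
    have h := Finset.mem_Icc.1 (Finset.mem_powerset.1 (Finset.mem_filter.1 hs).1
      (Finset.mem_image.2 ⟨d, by simp, sub_add_cancel ((n : ℤ) + 1) (d * r)⟩))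
    omega

theorem one_sub_X_mul_mk_numAP {d : ℕ} (hd : 1 ≤ d) :
    (1 - PowerSeries.X) * PowerSeries.mk (fun n => (numAP n (d + 1) : ℤ)) =
      PowerSeries.X * PowerSeries.mk (fun n => ((n / d : ℕ) : ℤ)) := by
  ext n
  cases n with
  | zero => simp [sub_mul, numAP_zero]
  | succ n => simp [sub_mul, PowerSeries.coeff_succ_X_mul, numAP_succ n hd]

theorem one_sub_X_pow_mul_mk_div {d : ℕ} (hd : 1 ≤ d) :
    (1 - PowerSeries.X ^ d) * PowerSeries.mk (fun n => ((n / d : ℕ) : ℤ)) =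
      PowerSeries.X ^ d * PowerSeries.mk 1 := by
  ext n
  rw [sub_mul, one_mul, map_sub, PowerSeries.coeff_X_pow_mul', PowerSeries.coeff_X_pow_mul']
  split_ifs with h
  · simp only [PowerSeries.coeff_mk, Nat.div_eq_sub_div hd h]
    simp
  · simp only [PowerSeries.coeff_mk, Nat.div_eq_of_lt (not_le.1 h)]
    simp

/-- For fixed `k ≥ 2`, the generating function of the numbers `p_{nk}` satisfies
`(1 - z^{k-1})(1-z)² ∑_{n≥0} p_{nk} zⁿ = z^k` as formal power series over `ℤ`. -/
theorem numAP_generating_function (k : ℕ) (hk : 2 ≤ k) :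
    (1 - (PowerSeries.X : PowerSeries ℤ)^(k-1)) * (1 - PowerSeries.X)^2 *
        PowerSeries.mk (fun n => (numAP n k : ℤ)) = PowerSeries.X ^ k := by
  obtain ⟨d, rfl⟩ : ∃ d, k = d + 1 := ⟨k - 1, by omega⟩
  have hd : 1 ≤ d := by omega
  rw [Nat.add_sub_cancel]
  calc (1 - (PowerSeries.X : PowerSeries ℤ) ^ d) * (1 - PowerSeries.X) ^ 2 *
        PowerSeries.mk (fun n => (numAP n (d + 1) : ℤ))
      = (1 - PowerSeries.X ^ d) * (1 - PowerSeries.X) *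
        ((1 - PowerSeries.X) * PowerSeries.mk (fun n => (numAP n (d + 1) : ℤ))) := by ring
    _ = PowerSeries.X * (1 - PowerSeries.X) *
        ((1 - PowerSeries.X ^ d) * PowerSeries.mk (fun n => ((n / d : ℕ) : ℤ))) := by
      rw [one_sub_X_mul_mk_numAP hd]; ring
    _ = PowerSeries.X ^ (d + 1) * (PowerSeries.mk 1 * (1 - PowerSeries.X)) := by
      rw [one_sub_X_pow_mul_mk_div hd]; ring
    _ = PowerSeries.X ^ (d + 1) := by
      rw [PowerSeries.mk_one_mul_one_sub_eq_one, mul_one]
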